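/- Let T be an invertible measure-preserving ergodic transformation of a standard Borel probability space (X, B, μ) and let ψ : X → ℤ^d be measurable. Then the skew product T_ψ : X × ℤ^d → X × ℤ^d, T_ψ(x, g) = (Tx, g + ψ(x)), preserving the product of μ with counting measure on ℤ^d, is ergodic if and only if E(ψ) = ℤ^d. -/

import Mathlib

open MeasureTheory Filter Topology

/-- The cocycle `ψ^{(n)}(x) = Σ_{0 ≤ j < n} ψ(T^j x)` for `n ≥ 0` and
`ψ^{(n)}(x) = -Σ_{n ≤ j < 0} ψ(T^j x)` for `n < 0`, for an invertible
transformation `T`. -/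
def cocycle {X G : Type*} [AddCommGroup G] (T : Equiv.Perm X) (ψ : X → G)
    (n : ℤ) (x : X) : G :=
  if 0 ≤ n then ∑ j ∈ Finset.range n.toNat, ψ ((T ^ (j : ℤ)) x)
  else -∑ j ∈ Finset.range (-n).toNat, ψ ((T ^ (n + (j : ℤ))) x)

/-- `g` is an essential value of the cocycle generated by `ψ : X → G` over `T`:
for every positive-measure measurable set `B` there is `n ∈ ℤ` with
`μ(B ∩ T⁻ⁿB ∩ {x : ψ⁽ⁿ⁾(x) = g}) > 0`. -/
def IsEssentialValue {X G : Type*} [AddCommGroup G] [MeasurableSpace X]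
    (μ : Measure X) (T : Equiv.Perm X) (ψ : X → G) (g : G) : Prop :=
  ∀ B : Set X, MeasurableSet B → 0 < μ B →
    ∃ n : ℤ, 0 < μ (B ∩ ⇑(T ^ n) ⁻¹' B ∩ {x | cocycle T ψ n x = g})

section SkewProduct

variable {X G : Type*} [AddCommGroup G]

theorem cocycle_zero (T : Equiv.Perm X) (ψ : X → G) (x : X) : cocycle T ψ 0 x = 0 := by
  simp [cocycle]

theorem cocycle_add_one (T : Equiv.Perm X) (ψ : X → G) (n : ℤ) (x : X) :
    cocycle T ψ (n + 1) x = cocycle T ψ n x + ψ ((T ^ n) x) := by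
  rcases le_or_gt 0 n with hn | hn
  · have h : (n + 1).toNat = n.toNat + 1 := by omega
    rw [cocycle, cocycle, if_pos (by omega), if_pos hn, h, Finset.sum_range_succ,
      Int.toNat_of_nonneg hn]
  · have hlt : cocycle T ψ (n + 1) x =
        -∑ j ∈ Finset.range (-(n + 1)).toNat, ψ ((T ^ (n + 1 + (j : ℤ))) x) := by
      rcases eq_or_ne n (-1) with rfl | hne
      · simp [cocycle]
      · rw [cocycle, if_neg (by omega)]
    have h : (-n).toNat = (-(n + 1)).toNat + 1 := by omega
    rw [hlt, cocycle, if_neg (by omega), h, Finset.sum_range_succ']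
    simp only [Nat.cast_add, Nat.cast_one, Nat.cast_zero, add_zero, neg_add_rev]
    rw [neg_add_cancel_comm]
    simp only [add_assoc, add_comm (1 : ℤ)]

/-- The skew product `(x, g) ↦ (T x, g + ψ x)` as a permutation of `X × G`. -/
def skewPerm (T : Equiv.Perm X) (ψ : X → G) : Equiv.Perm (X × G) where
  toFun p := (T p.1, p.2 + ψ p.1)
  invFun p := (T.symm p.1, p.2 - ψ (T.symm p.1))
  left_inv p := by simp
  right_inv p := by simp

theorem skewPerm_apply (T : Equiv.Perm X) (ψ : X → G) (p : X × G) :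
    skewPerm T ψ p = (T p.1, p.2 + ψ p.1) := rfl

theorem skewPerm_zpow_apply (T : Equiv.Perm X) (ψ : X → G) (n : ℤ) (x : X) (g : G) :
    (skewPerm T ψ ^ n) (x, g) = ((T ^ n) x, g + cocycle T ψ n x) := by
  have hstep (n : ℤ) : (skewPerm T ψ ^ (n + 1)) (x, g) =
      skewPerm T ψ ((skewPerm T ψ ^ n) (x, g)) := by
    rw [add_comm, zpow_add, zpow_one, Equiv.Perm.mul_apply]
  have hstepT (n : ℤ) : (T ^ (n + 1)) x = T ((T ^ n) x) := by
    rw [add_comm, zpow_add, zpow_one, Equiv.Perm.mul_apply]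
  have hiff (n : ℤ) : (skewPerm T ψ ^ n) (x, g) = ((T ^ n) x, g + cocycle T ψ n x) ↔
      (skewPerm T ψ ^ (n + 1)) (x, g) = ((T ^ (n + 1)) x, g + cocycle T ψ (n + 1) x) := by
    rw [hstep, hstepT, cocycle_add_one, ← add_assoc,
      ← skewPerm_apply T ψ ((T ^ n) x, g + cocycle T ψ n x), (skewPerm T ψ).apply_eq_iff_eq]
  induction n using Int.induction_on with
  | zero => simp [cocycle_zero]
  | succ n ih => exact (hiff n).1 ih
  | pred n ih => exact (hiff _).2 (by rwa [sub_add_cancel])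

theorem Equiv.Perm.zpow_preimage_eq {α : Type*} {S : Equiv.Perm α} {A : Set α}
    (hA : S ⁻¹' A = A) (n : ℤ) : ⇑(S ^ n) ⁻¹' A = A := by
  have hstep (n : ℤ) : ⇑(S ^ (n + 1)) ⁻¹' A = ⇑(S ^ n) ⁻¹' A := by
    rw [add_comm, zpow_add, zpow_one, Equiv.Perm.coe_mul, Set.preimage_comp, hA]
  induction n using Int.induction_on with
  | zero => simp
  | succ n ih => rw [hstep, ih]
  | pred n ih => rwa [← hstep, sub_add_cancel]

theorem Equiv.Perm.measurable_zpow {α : Type*} [MeasurableSpace α] {S : Equiv.Perm α}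
    (hS : Measurable S) (hSinv : Measurable S.symm) (n : ℤ) : Measurable ⇑(S ^ n) := by
  induction n using Int.induction_on with
  | zero => simpa using measurable_id
  | succ n ih =>
    rw [zpow_add, zpow_one, Equiv.Perm.coe_mul]
    exact ih.comp hS
  | pred n ih =>
    rw [sub_eq_add_neg, zpow_add, zpow_neg_one, Equiv.Perm.coe_mul]
    exact ih.comp hSinv

variable [MeasurableSpace X] [Countable G] [MeasurableSpace G] [DiscreteMeasurableSpace G]
  {μ : Measure X} {T : Equiv.Perm X} {ψ : X → G}

theorem measurePreserving_skewPerm [SFinite μ] (hT : MeasurePreserving T μ μ)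
    (hψ : Measurable ψ) :
    MeasurePreserving (skewPerm T ψ) (μ.prod Measure.count) (μ.prod Measure.count) := by
  refine hT.skew_product (g := fun x g => g + ψ x) ?_ (Eventually.of_forall fun x => ?_)
  · exact (Measurable.of_discrete (f := fun q : G × G => q.1 + q.2)).comp
      (measurable_snd.prodMk (hψ.comp measurable_fst))
  · exact map_add_right_eq_self Measure.count (ψ x)

theorem isEssentialValue_of_ergodic_skewPerm [SFinite μ]
    (hTinv : Measurable T.symm) (hψ : Measurable ψ)
    (h : Ergodic (skewPerm T ψ) (μ.prod Measure.count)) (g : G) :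
    IsEssentialValue μ T ψ g := by
  intro B hB hμB
  by_contra! hzero
  have hSinv : Measurable (skewPerm T ψ).symm :=
    (hTinv.comp measurable_fst).prodMk
      ((Measurable.of_discrete (f := fun q : G × G => q.1 - q.2)).comp
        (measurable_snd.prodMk (hψ.comp (hTinv.comp measurable_fst))))
  have hmeas (n : ℤ) : MeasurableSet (⇑(skewPerm T ψ ^ n) ⁻¹' (B ×ˢ {g})) :=
    Equiv.Perm.measurable_zpow h.measurable hSinv n (hB.prod .of_discrete)
  have hpos (g : G) : 0 < μ.prod Measure.count (B ×ˢ {g}) := by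
    simpa [Measure.prod_prod] using hμB
  set A : Set (X × G) := ⋃ n : ℤ, ⇑(skewPerm T ψ ^ n) ⁻¹' (B ×ˢ {g}) with hA
  have hinv : skewPerm T ψ ⁻¹' A = A := by
    rw [hA, Set.preimage_iUnion]
    refine Set.iUnion_congr_of_surjective _ (Equiv.addRight (1 : ℤ)).surjective fun n => ?_
    rw [← Set.preimage_comp, ← Equiv.Perm.coe_mul, ← zpow_add_one, Equiv.coe_addRight]
  have hBA : B ×ˢ {g} ⊆ A := fun p hp => Set.mem_iUnion.2 ⟨0, by simpa using hp⟩
  rcases h.toPreErgodic.measure_self_or_compl_eq_zero (.iUnion hmeas) hinv with h0 | h0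
  · exact (hpos g).ne' (measure_mono_null hBA h0)
  · refine (hpos 0).ne' (measure_mono_null (t := Aᶜ ∪ ⋃ n : ℤ,
      (B ∩ ⇑(T ^ n) ⁻¹' B ∩ {x | cocycle T ψ n x = g}) ×ˢ {(0 : G)}) ?_ ?_)
    · rintro ⟨x, k⟩ ⟨hx, rfl : k = 0⟩
      by_cases hxA : (x, (0 : G)) ∈ A
      · obtain ⟨n, hn⟩ := Set.mem_iUnion.1 hxA
        rw [Set.mem_preimage, skewPerm_zpow_apply, zero_add] at hn
        exact Or.inr (Set.mem_iUnion.2 ⟨n, ⟨⟨hx, hn.1⟩, hn.2⟩, rfl⟩)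
      · exact Or.inl hxA
    · refine measure_union_null h0 (measure_iUnion_null fun n => ?_)
      rw [Measure.prod_prod, nonpos_iff_eq_zero.1 (hzero n), zero_mul]

theorem ergodic_skewPerm_of_forall_isEssentialValue [SFinite μ] (hT : Ergodic T μ)
    (hψ : Measurable ψ) (h : ∀ g, IsEssentialValue μ T ψ g) :
    Ergodic (skewPerm T ψ) (μ.prod Measure.count) := by
  refine ⟨measurePreserving_skewPerm hT.toMeasurePreserving hψ, ⟨fun A hA hinv => ?_⟩⟩
  have hsec (g : G) : MeasurableSet {x | (x, g) ∈ A} := measurable_prodMk_right hA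
  have hmem (n : ℤ) (x : X) (g : G) :
      (x, g) ∈ A ↔ ((T ^ n) x, g + cocycle T ψ n x) ∈ A := by
    rw [← skewPerm_zpow_apply]
    exact (Set.ext_iff.1 (Equiv.Perm.zpow_preimage_eq hinv n) (x, g)).symm
  have hdiff (g k : G) : μ ({x | (x, g) ∈ A} \ {x | (x, k) ∈ A}) = 0 := by
    by_contra hne
    obtain ⟨n, hn⟩ := h (k - g) _ ((hsec g).diff (hsec k)) (pos_iff_ne_zero.2 hne)
    obtain ⟨x, ⟨⟨hxg, -⟩, -, hxk⟩, hc : cocycle T ψ n x = k - g⟩ :=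
      nonempty_of_measure_ne_zero hn.ne'
    refine hxk ?_
    have := (hmem n x g).1 hxg
    rwa [hc, add_sub_cancel] at this
  have hae : ∀ᵐ x ∂μ, ∀ g, ((x, g) ∈ A ↔ (x, (0 : G)) ∈ A) := by
    rw [ae_all_iff]
    intro g
    exact (ae_eq_set.2 ⟨hdiff g 0, hdiff 0 g⟩).mem_iff
  have hinv0 : T ⁻¹' {x | (x, (0 : G)) ∈ A} =ᵐ[μ] {x | (x, (0 : G)) ∈ A} := by
    refine eventuallyEq_set.2 ?_
    filter_upwards [hT.quasiMeasurePreserving.ae hae] with x hx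
    exact (hx (0 + ψ x)).symm.trans (Set.ext_iff.1 hinv (x, 0))
  have hprod {p : X → Prop} (hp : ∀ᵐ x ∂μ, p x) :
      ∀ᵐ q ∂μ.prod (Measure.count : Measure G), p q.1 :=
    Measure.quasiMeasurePreserving_fst.ae hp
  rw [eventuallyConst_set']
  rcases hT.quasiErgodic.ae_empty_or_univ₀ (hsec 0).nullMeasurableSet hinv0 with h0 | h0
  · left
    refine eventuallyEq_set.2 ?_
    filter_upwards [hprod hae, hprod h0.mem_iff] with q hq hq0
    exact (hq q.2).trans hq0
  · right
    refine eventuallyEq_set.2 ?_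
    filter_upwards [hprod hae, hprod h0.mem_iff] with q hq hq0
    exact (hq q.2).trans hq0

end SkewProduct

/-- The skew product `T_ψ(x, g) = (Tx, g + ψ(x))` on `X × ℤ^d`, preserving the
product of `μ` with the counting measure on `ℤ^d`, is ergodic if and only if
every element of `ℤ^d` is an essential value of `ψ`, i.e. `E(ψ) = ℤ^d`. -/
theorem stmt_10 {X : Type*} [MeasurableSpace X] [StandardBorelSpace X] {d : ℕ}
    (μ : Measure X) [IsProbabilityMeasure μ]
    (T : Equiv.Perm X) (hT : Measurable T) (hTinv : Measurable T.symm)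
    (herg : Ergodic T μ)
    (ψ : X → Fin d → ℤ) (hψ : Measurable ψ) :
    Ergodic (fun p : X × (Fin d → ℤ) => (T p.1, p.2 + ψ p.1))
        (μ.prod Measure.count) ↔
      {g : Fin d → ℤ | IsEssentialValue μ T ψ g} = Set.univ := by
  rw [Set.eq_univ_iff_forall]
  exact ⟨isEssentialValue_of_ergodic_skewPerm hTinv hψ,
    ergodic_skewPerm_of_forall_isEssentialValue herg hψ⟩
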